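/- For all integers m, n with n ≠ 0 (so that F(n) ≠ 0) and every nonnegative integer k: ∑_{j=0}^{k} ∑_{s=0}^{j} (-1)^{n·(j+s)+s} · C(k,j) · C(j,s) · G(m−2k−(n−1)·j+2n·s) / F(n)^j = (-1)^k · G(m), where C(k,j) denotes the binomial coefficient. -/

import Mathlib

/-- A two-sided Fibonacci-type sequence is determined by its values at `0` and `1`. -/
theorem fibRec_ext {A B : ℤ → ℝ} (hA : ∀ m : ℤ, A m = A (m - 1) + A (m - 2))
    (hB : ∀ m : ℤ, B m = B (m - 1) + B (m - 2)) (h0 : A 0 = B 0) (h1 : A 1 = B 1) (m : ℤ) :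
    A m = B m := by
  suffices h : A m = B m ∧ A (m + 1) = B (m + 1) from h.1
  induction m using Int.induction_on with
  | zero => exact ⟨h0, by simpa using h1⟩
  | succ i ih =>
    refine ⟨ih.2, ?_⟩
    have hA' := hA (i + 1 + 1)
    have hB' := hB (i + 1 + 1)
    rw [show (i : ℤ) + 1 + 1 - 1 = i + 1 by ring, show (i : ℤ) + 1 + 1 - 2 = i by ring] at hA' hB'
    rw [hA', hB', ih.1, ih.2]
  | pred i ih =>
    have hA' := hA (-i + 1)
    have hB' := hB (-i + 1)
    rw [show -(i : ℤ) + 1 - 1 = -i by ring, show -(i : ℤ) + 1 - 2 = -i - 1 by ring] at hA' hB'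
    rw [sub_add_cancel]
    exact ⟨by linarith [ih.1, ih.2], ih.1⟩

/-- Integer powers of a root of `x ^ 2 = x + 1` satisfy the Fibonacci recurrence. -/
theorem zpow_fibRec {x : ℝ} (hx : x ^ 2 = x + 1) (m : ℤ) :
    x ^ m = x ^ (m - 1) + x ^ (m - 2) := by
  have hx0 : x ≠ 0 := by rintro rfl; norm_num at hx
  have h1 : x ^ m = x ^ (m - 2) * x ^ 2 := by
    rw [← zpow_natCast, ← zpow_add₀ hx0]; congr 1; push_cast; ring
  have h2 : x ^ (m - 1) = x ^ (m - 2) * x := by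
    rw [← zpow_add_one₀ hx0]; congr 1; ring
  rw [h1, h2, hx]; ring

/-- Binet's formula, for either ordering of the two roots. -/
theorem zpow_sub_zpow_eq_mul_fib {F : ℤ → ℝ} (hF0 : F 0 = 0) (hF1 : F 1 = 1)
    (hF : ∀ m : ℤ, F m = F (m - 1) + F (m - 2)) {x y : ℝ} (hx : x ^ 2 = x + 1)
    (hy : y ^ 2 = y + 1) (n : ℤ) : x ^ n - y ^ n = (x - y) * F n := by
  refine fibRec_ext (A := fun n => x ^ n - y ^ n) (B := fun n => (x - y) * F n) ?_ ?_ ?_ ?_ n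
  · intro m
    rw [zpow_fibRec hx m, zpow_fibRec hy m]; ring
  · intro m
    rw [hF m]; ring
  · simp [hF0]
  · simp [hF1]

/-- Binet-type formula for a generalized Fibonacci sequence. -/
theorem exists_eq_mul_goldenRatio_zpow_add {G : ℤ → ℝ}
    (hG : ∀ m : ℤ, G m = G (m - 1) + G (m - 2)) :
    ∃ a b : ℝ, ∀ m : ℤ, G m = a * Real.goldenRatio ^ m + b * Real.goldenConj ^ m := by
  have hne : Real.goldenRatio - Real.goldenConj ≠ 0 := by
    exact (sub_pos.2 (Real.goldenConj_neg.trans Real.goldenRatio_pos)).ne'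
  refine ⟨(G 1 - G 0 * Real.goldenConj) / (Real.goldenRatio - Real.goldenConj),
    (G 0 * Real.goldenRatio - G 1) / (Real.goldenRatio - Real.goldenConj),
    fibRec_ext hG ?_ ?_ ?_⟩
  · intro m
    rw [zpow_fibRec Real.goldenRatio_sq m, zpow_fibRec Real.goldenConj_sq m]; ring
  · simp only [zpow_zero]
    field_simp
    ring
  · simp only [zpow_one]
    field_simp
    ring

/-- The two-sided Fibonacci numbers vanish only at `0`. -/
theorem fib_ne_zero {F : ℤ → ℝ} (hF0 : F 0 = 0) (hF1 : F 1 = 1)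
    (hF : ∀ m : ℤ, F m = F (m - 1) + F (m - 2)) {n : ℤ} (hn : n ≠ 0) : F n ≠ 0 := by
  intro h
  have hb := zpow_sub_zpow_eq_mul_fib hF0 hF1 hF Real.goldenRatio_sq Real.goldenConj_sq n
  rw [h, mul_zero, sub_eq_zero] at hb
  have habs : |Real.goldenConj| = Real.goldenRatio⁻¹ := by
    rw [abs_of_neg Real.goldenConj_neg, Real.inv_goldenRatio]
  have h1 : Real.goldenRatio ^ n = Real.goldenRatio ^ (-n) := by
    have := congrArg abs hb
    rwa [abs_zpow, abs_zpow, habs, abs_of_pos Real.goldenRatio_pos, inv_zpow'] at this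
  have := zpow_right_injective₀ Real.goldenRatio_pos Real.one_lt_goldenRatio.ne' h1
  omega

/-- The double binomial sum for the geometric sequence `m ↦ x ^ m`, where `x` and `y` are the
two roots of the Fibonacci characteristic polynomial. -/
theorem sum_sum_choose_zpow {x y f : ℝ} (hx : x ^ 2 = x + 1) (hxy : x * y = -1) (hf : f ≠ 0)
    {n : ℤ} (hb : x ^ n - y ^ n = (x - y) * f) (m : ℤ) (k : ℕ) :
    ∑ j ∈ Finset.range (k + 1), ∑ s ∈ Finset.range (j + 1),
        (-1 : ℝ) ^ (n * ((j : ℤ) + s) + s) * (Nat.choose k j : ℝ)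
          * (Nat.choose j s : ℝ)
          * x ^ (m - 2 * k - (n - 1) * j + 2 * n * s) / f ^ j
      = (-1 : ℝ) ^ k * x ^ m := by
  have hx0 : x ≠ 0 := by rintro rfl; norm_num at hx
  have hneg : (-1 : ℝ) ≠ 0 := by norm_num
  have hyn : y ^ n = (-1) ^ n * (x ^ n)⁻¹ := by
    rw [← hxy, mul_zpow]; field_simp
  have hsq : ((-1 : ℝ) ^ n) * (-1) ^ n = 1 := by
    rw [← mul_zpow]; norm_num
  have hterm (j s : ℕ) : (-1 : ℝ) ^ (n * ((j : ℤ) + s) + s) * (Nat.choose k j : ℝ)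
        * (Nat.choose j s : ℝ) * x ^ (m - 2 * k - (n - 1) * j + 2 * n * s) / f ^ j
      = x ^ (m - 2 * k) * ((((-1) ^ n * (x ^ n)⁻¹ * x / f) ^ j * (Nat.choose k j : ℝ)) *
        ((-(-1) ^ n * (x ^ n * x ^ n)) ^ s * (Nat.choose j s : ℝ))) := by
    have e1 : (-1 : ℝ) ^ (n * ((j : ℤ) + s) + s) =
        ((-1) ^ n) ^ j * ((-1) ^ n) ^ s * (-1) ^ s := by
      rw [zpow_add₀ hneg, zpow_mul, zpow_add₀ (zpow_ne_zero _ hneg)]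
      simp only [zpow_natCast]
    have e2 : x ^ (m - 2 * k - (n - 1) * j + 2 * n * s) =
        x ^ (m - 2 * k) * ((x ^ n)⁻¹ * x) ^ j * (x ^ n * x ^ n) ^ s := by
      rw [← zpow_neg, ← zpow_add_one₀ hx0, ← zpow_add₀ hx0, ← zpow_natCast, ← zpow_natCast,
        ← zpow_mul, ← zpow_mul, ← zpow_add₀ hx0, ← zpow_add₀ hx0]
      congr 1; ring
    rw [e1, e2, neg_mul, neg_pow (_ * _) s]
    simp only [mul_pow, div_pow]
    ring
  have hbase : (-1) ^ n * (x ^ n)⁻¹ * x / f * (-(-1) ^ n * (x ^ n * x ^ n) + 1) + 1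
      = -x ^ 2 := by
    have h1 : (-1) ^ n * (x ^ n)⁻¹ * x / f * (-(-1) ^ n * (x ^ n * x ^ n) + 1)
        = x / f * (y ^ n - x ^ n) := by
      have hxn : x ^ n ≠ 0 := zpow_ne_zero _ hx0
      rw [hyn]
      field_simp
      linear_combination (-(x ^ n) ^ 2) * hsq
    have h2 : y ^ n - x ^ n = -((x - y) * f) := by rw [← hb]; ring
    rw [h1, h2]
    field_simp
    linear_combination hxy
  simp only [hterm, ← Finset.mul_sum]
  have hinner (j : ℕ) : ∑ s ∈ Finset.range (j + 1),
      (-(-1) ^ n * (x ^ n * x ^ n)) ^ s * (Nat.choose j s : ℝ)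
        = (-(-1) ^ n * (x ^ n * x ^ n) + 1) ^ j := by
    rw [add_pow]; simp
  have houter : ∑ j ∈ Finset.range (k + 1), ((-1) ^ n * (x ^ n)⁻¹ * x / f) ^ j *
      (Nat.choose k j : ℝ) * (-(-1) ^ n * (x ^ n * x ^ n) + 1) ^ j = (-x ^ 2) ^ k := by
    rw [← hbase, add_pow]
    refine Finset.sum_congr rfl fun j _ => ?_
    rw [mul_pow _ (_ + 1), one_pow]; ring
  simp only [hinner]
  rw [houter, neg_pow, ← pow_mul, mul_left_comm, ← zpow_natCast x, ← zpow_add₀ hx0]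
  congr 2; push_cast; ring


/-- Weighted double binomial sum identity for generalized Fibonacci sequences. -/
theorem stmt_11 (F G : ℤ → ℝ)
    (hF0 : F 0 = 0) (hF1 : F 1 = 1)
    (hF : ∀ m : ℤ, F m = F (m - 1) + F (m - 2))
    (hG : ∀ m : ℤ, G m = G (m - 1) + G (m - 2))
    (m n : ℤ) (hn : n ≠ 0) (k : ℕ) :
    ∑ j ∈ Finset.range (k + 1), ∑ s ∈ Finset.range (j + 1),
        (-1 : ℝ) ^ (n * ((j : ℤ) + s) + s) * (Nat.choose k j : ℝ)
          * (Nat.choose j s : ℝ)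
          * G (m - 2 * k - (n - 1) * j + 2 * n * s) / F n ^ j
      = (-1 : ℝ) ^ k * G m := by
  obtain ⟨a, b, hab⟩ := exists_eq_mul_goldenRatio_zpow_add hG
  have hf := fib_ne_zero hF0 hF1 hF hn
  have h1 := sum_sum_choose_zpow Real.goldenRatio_sq Real.goldenRatio_mul_goldenConj hf
    (zpow_sub_zpow_eq_mul_fib hF0 hF1 hF Real.goldenRatio_sq Real.goldenConj_sq n) m k
  have h2 := sum_sum_choose_zpow Real.goldenConj_sq Real.goldenConj_mul_goldenRatio hf
    (zpow_sub_zpow_eq_mul_fib hF0 hF1 hF Real.goldenConj_sq Real.goldenRatio_sq n) m k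
  have h3 := congrArg₂ (fun u v => a * u + b * v) h1 h2
  simp only [Finset.mul_sum, ← Finset.sum_add_distrib] at h3
  simp only [hab]
  refine Eq.trans (Finset.sum_congr rfl fun j _ => Finset.sum_congr rfl fun s _ => ?_)
    (h3.trans ?_) <;> ring
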